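/- Let θ₀ ∈ L²(0,1) and let θ₀^odd denote its odd extension to ℝ (equal to θ₀(x) on (0,1), to −θ₀(−x) on (−1,0), and to 0 outside (−1,1)). Define E(t,x) := e^{i x²/(4t)} / √(4π i t) for t ≠ 0, and θ⁻(t,x) := ∫_{−1}^{1} E(t, x−y) θ₀^odd(y) dy. Then for all 0 < t₁ < t₂ and all L > 0, the function θ⁻ is Gevrey of order (1, 1/2) on [t₁,t₂] × [−L,L]: there exist constants M, R₁, R₂ > 0 such that |∂_t^{p₁} ∂_x^{p₂} θ⁻(t,x)| ≤ M (p₁!)·(p₂!)^{1/2} / (R₁^{p₁} R₂^{p₂}) for all (t,x) ∈ [t₁,t₂] × [−L,L] and all integers p₁, p₂ ≥ 0. -/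

import Mathlib

open MeasureTheory Complex Real Set Filter

/-- The fundamental solution `E(t,x) = e^{i x²/(4t)} / √(4π i t)` of the 1D Schrödinger
equation, the complex square root being the principal branch. -/
noncomputable def E (t x : ℝ) : ℂ :=
  Complex.exp (Complex.I * (x : ℂ) ^ 2 / (4 * (t : ℂ))) /
    ((4 * (Real.pi : ℂ) * Complex.I * (t : ℂ)) ^ ((1 : ℂ) / 2))

/-- The odd extension of `θ₀ : (0,1) → ℂ` to `ℝ`. -/
noncomputable def thetaOdd (θ₀ : ℝ → ℂ) (x : ℝ) : ℂ :=
  if 0 < x ∧ x < 1 then θ₀ x else if -1 < x ∧ x < 0 then -θ₀ (-x) else 0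

/-- `θ⁻(t,x) = ∫_{-1}^1 E(t, x-y) θ₀^odd(y) dy`. -/
noncomputable def thetaMinus (θ₀ : ℝ → ℂ) (t x : ℝ) : ℂ :=
  ∫ y in Set.Ioo (-1 : ℝ) 1, E t (x - y) * thetaOdd θ₀ y

/-- Differentiation under the integral sign for a jointly continuous kernel with jointly continuous
derivative, integrated against an integrable density over a subset of a compact set. -/
theorem hasDerivAt_setIntegral_mul {U : Set ℂ} (hU : IsOpen U) {K s : Set ℝ} (hK : IsCompact K)
    (hs : MeasurableSet s) (hsK : s ⊆ K) {θ : ℝ → ℂ} (hθ : IntegrableOn θ s) {k k' : ℂ → ℝ → ℂ}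
    (hk : ContinuousOn (Function.uncurry k) (U ×ˢ K))
    (hk' : ContinuousOn (Function.uncurry k') (U ×ˢ K))
    (hd : ∀ z ∈ U, ∀ y ∈ K, HasDerivAt (fun z => k z y) (k' z y) z) {z₀ : ℂ} (hz₀ : z₀ ∈ U) :
    HasDerivAt (fun z => ∫ y in s, k z y * θ y) (∫ y in s, k' z₀ y * θ y) z₀ := by
  obtain ⟨ε, hε, hball⟩ := Metric.nhds_basis_closedBall.mem_iff.1 (hU.mem_nhds hz₀)
  have hcomp := (isCompact_closedBall z₀ ε).prod hK
  have hsub : Metric.closedBall z₀ ε ×ˢ K ⊆ U ×ˢ K := Set.prod_mono hball le_rfl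
  obtain ⟨C, hC⟩ := hcomp.exists_bound_of_continuousOn (hk.mono hsub)
  obtain ⟨C', hC'⟩ := hcomp.exists_bound_of_continuousOn (hk'.mono hsub)
  have hslice : ∀ {f : ℂ → ℝ → ℂ}, ContinuousOn (Function.uncurry f) (U ×ˢ K) → ∀ z ∈ U,
      AEStronglyMeasurable (f z) (volume.restrict s) := by
    intro f hf z hz
    have : ContinuousOn (f z) s :=
      hf.comp (f := fun y => (z, y)) (by fun_prop) fun y hy => ⟨hz, hsK hy⟩
    exact this.aestronglyMeasurable hs
  have hae : ∀ᵐ y ∂(volume.restrict s), y ∈ K :=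
    (ae_restrict_mem hs).mono fun y hy => hsK hy
  refine (hasDerivAt_integral_of_dominated_loc_of_deriv_le (F := fun z y => k z y * θ y)
    (F' := fun z y => k' z y * θ y) (bound := fun y => C' * ‖θ y‖)
    (Metric.closedBall_mem_nhds z₀ hε) ?_ ?_ ?_ ?_ ?_ ?_).2
  · filter_upwards [hU.mem_nhds hz₀] with z hz
    exact (hslice hk z hz).mul hθ.aestronglyMeasurable
  · refine Integrable.bdd_mul hθ (hslice hk z₀ hz₀) (c := C) ?_
    filter_upwards [hae] with y hy
    exact hC (z₀, y) ⟨Metric.mem_closedBall_self hε.le, hy⟩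
  · exact (hslice hk' z₀ hz₀).mul hθ.aestronglyMeasurable
  · filter_upwards [hae] with y hy z hz
    rw [norm_mul]
    exact mul_le_mul_of_nonneg_right (hC' (z, y) ⟨hz, hy⟩) (norm_nonneg _)
  · exact hθ.norm.const_mul _
  · filter_upwards [hae] with y hy z hz
    exact (hd z (hball hz) y hy).mul_const _

/-- The real iterated derivatives of the restriction to `ℝ` of a holomorphic function are the
restrictions of the complex ones. -/
theorem iteratedDeriv_comp_ofReal {U : Set ℂ} (hU : IsOpen U) {f : ℂ → ℂ}
    (hf : DifferentiableOn ℂ f U) (n : ℕ) {x : ℝ} (hx : (x : ℂ) ∈ U) :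
    iteratedDeriv n (fun x : ℝ => f x) x = iteratedDeriv n f x := by
  induction n generalizing f with
  | zero => simp
  | succ n ih =>
    rw [iteratedDeriv_succ', iteratedDeriv_succ', ← ih (hf.deriv hU)]
    refine Filter.EventuallyEq.iteratedDeriv_eq n ?_
    filter_upwards [(hU.preimage Complex.continuous_ofReal).mem_nhds hx] with y hy
    exact ((hf.differentiableAt (hU.mem_nhds hy)).hasDerivAt.comp_ofReal).deriv

/-- The domain `{Re z > 0} × ℂ` of the complexified kernel. -/
def rightHalf : Set (ℂ × ℂ) := {q | 0 < q.1.re}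

theorem isOpen_re_pos : IsOpen {z : ℂ | 0 < z.re} :=
  isOpen_lt continuous_const Complex.continuous_re

/-- The convolution in the second variable of a kernel with a density on `(-1,1)`. -/
noncomputable def convKernel (θ : ℝ → ℂ) (g : ℂ × ℂ → ℂ) (z w : ℂ) : ℂ :=
  ∫ y in Set.Ioo (-1 : ℝ) 1, g (z, w - y) * θ y

section Convolution

variable {θ : ℝ → ℂ} (hθ : IntegrableOn θ (Set.Ioo (-1 : ℝ) 1)) {g : ℂ × ℂ → ℂ}
  (hg : AnalyticOnNhd ℂ g rightHalf)

theorem analyticOnNhd_fderiv_apply {g : ℂ × ℂ → ℂ} (hg : AnalyticOnNhd ℂ g rightHalf)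
    (v : ℂ × ℂ) : AnalyticOnNhd ℂ (fun q => fderiv ℂ g q v) rightHalf :=
  (ContinuousLinearMap.apply ℂ ℂ v).comp_analyticOnNhd hg.fderiv

include hθ hg

theorem hasDerivAt_convKernel_snd {z : ℂ} (hz : 0 < z.re) (w : ℂ) :
    HasDerivAt (convKernel θ g z) (convKernel θ (fun q => fderiv ℂ g q (0, 1)) z w) w := by
  have hc : ∀ {h : ℂ × ℂ → ℂ}, AnalyticOnNhd ℂ h rightHalf →
      ContinuousOn (Function.uncurry fun (w : ℂ) (y : ℝ) => h (z, w - y))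
        (Set.univ ×ˢ Set.Icc (-1 : ℝ) 1) := fun {h} hh =>
    hh.continuousOn.comp (f := fun p : ℂ × ℝ => (z, p.1 - (p.2 : ℂ))) (by fun_prop)
      fun p _ => hz
  refine hasDerivAt_setIntegral_mul isOpen_univ isCompact_Icc measurableSet_Ioo
    Set.Ioo_subset_Icc_self hθ (hc hg) (hc (analyticOnNhd_fderiv_apply hg _)) ?_ (Set.mem_univ w)
  intro w _ y _
  have h1 : HasDerivAt (fun w : ℂ => (z, w - (y : ℂ))) ((0 : ℂ), (1 : ℂ)) w :=
    (hasDerivAt_const w z).prodMk ((hasDerivAt_id w).sub_const _)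
  exact (hg (z, w - y) hz).differentiableAt.hasFDerivAt.comp_hasDerivAt w h1

theorem hasDerivAt_convKernel_fst {z : ℂ} (hz : 0 < z.re) (w : ℂ) :
    HasDerivAt (fun z => convKernel θ g z w)
      (convKernel θ (fun q => fderiv ℂ g q (1, 0)) z w) z := by
  have hc : ∀ {h : ℂ × ℂ → ℂ}, AnalyticOnNhd ℂ h rightHalf →
      ContinuousOn (Function.uncurry fun (z : ℂ) (y : ℝ) => h (z, w - y))
        ({z : ℂ | 0 < z.re} ×ˢ Set.Icc (-1 : ℝ) 1) := fun {h} hh =>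
    hh.continuousOn.comp (f := fun p : ℂ × ℝ => (p.1, w - (p.2 : ℂ))) (by fun_prop)
      fun p hp => hp.1
  refine hasDerivAt_setIntegral_mul isOpen_re_pos isCompact_Icc measurableSet_Ioo
    Set.Ioo_subset_Icc_self hθ (hc hg) (hc (analyticOnNhd_fderiv_apply hg _)) ?_ hz
  intro z hz y _
  have h1 : HasDerivAt (fun z : ℂ => (z, w - (y : ℂ))) ((1 : ℂ), (0 : ℂ)) z :=
    (hasDerivAt_id z).prodMk (hasDerivAt_const z _)
  exact (hg (z, w - y) hz).differentiableAt.hasFDerivAt.comp_hasDerivAt z h1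

theorem differentiableOn_iteratedDeriv_convKernel (n : ℕ) (w : ℂ) :
    DifferentiableOn ℂ (fun z => iteratedDeriv n (convKernel θ g z) w) {z | 0 < z.re} := by
  induction n generalizing g with
  | zero =>
    intro z hz
    simpa using (hasDerivAt_convKernel_fst hθ hg hz w).differentiableAt.differentiableWithinAt
  | succ n ih =>
    refine (ih (analyticOnNhd_fderiv_apply hg (0, 1))).congr fun z hz => ?_
    rw [iteratedDeriv_succ']
    congr 1
    ext w
    exact (hasDerivAt_convKernel_snd hθ hg hz w).deriv

theorem iteratedDeriv_iteratedDeriv_convKernel_ofReal (m n : ℕ) {t : ℝ} (ht : 0 < t) (x : ℝ) :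
    iteratedDeriv m (fun t' : ℝ => iteratedDeriv n (fun x' : ℝ => convKernel θ g t' x') x) t =
      iteratedDeriv m (fun z => iteratedDeriv n (convKernel θ g z) x) t := by
  rw [← iteratedDeriv_comp_ofReal isOpen_re_pos
    (differentiableOn_iteratedDeriv_convKernel hθ hg n x) m (by simpa using ht)]
  refine Filter.EventuallyEq.iteratedDeriv_eq m ?_
  filter_upwards [lt_mem_nhds ht] with s hs
  refine iteratedDeriv_comp_ofReal isOpen_univ (fun w _ => ?_) n (Set.mem_univ _)
  exact (hasDerivAt_convKernel_snd hθ hg (by simpa using hs)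
    w).differentiableAt.differentiableWithinAt

/-- Cauchy's estimates in both variables. -/
theorem norm_iteratedDeriv_iteratedDeriv_convKernel_le (m n : ℕ) {t x ρ r C : ℝ} (hρ : 0 < ρ)
    (hρt : ρ < t) (hr : 0 < r)
    (hC : ∀ z w : ℂ, ‖z - t‖ ≤ ρ → ‖w - x‖ ≤ r → ‖convKernel θ g z w‖ ≤ C) :
    ‖iteratedDeriv m (fun t' : ℝ => iteratedDeriv n (fun x' : ℝ => convKernel θ g t' x') x) t‖ ≤
      m.factorial * (n.factorial * C / r ^ n) / ρ ^ m := by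
  have hre : Metric.closedBall (t : ℂ) ρ ⊆ {z : ℂ | 0 < z.re} := by
    intro z hz
    rw [Metric.mem_closedBall, dist_eq_norm] at hz
    have := (abs_le.1 ((Complex.abs_re_le_norm _).trans hz)).1
    simp only [Complex.sub_re, Complex.ofReal_re] at this
    show 0 < z.re
    linarith
  rw [iteratedDeriv_iteratedDeriv_convKernel_ofReal hθ hg m n (hρ.trans hρt)]
  refine Complex.norm_iteratedDeriv_le_of_forall_mem_sphere_norm_le m hρ
    ((differentiableOn_iteratedDeriv_convKernel hθ hg n x).diffContOnCl_ball hre) fun z hz => ?_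
  have hzc := Metric.sphere_subset_closedBall hz
  have hd : Differentiable ℂ (convKernel θ g z) := fun w =>
    (hasDerivAt_convKernel_snd hθ hg (hre hzc) w).differentiableAt
  refine Complex.norm_iteratedDeriv_le_of_forall_mem_sphere_norm_le n hr hd.diffContOnCl
    fun w hw => hC z w ?_ ?_
  · simpa [dist_eq_norm] using hzc
  · rw [← dist_eq_norm]
    exact (Metric.mem_sphere.1 hw).le

end Convolution

/-- The kernel `E` with both variables complexified. -/
noncomputable def complexE (q : ℂ × ℂ) : ℂ :=
  Complex.exp (Complex.I * q.2 ^ 2 / (4 * q.1)) /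
    ((4 * (Real.pi : ℂ) * Complex.I * q.1) ^ ((1 : ℂ) / 2))

theorem analyticOnNhd_complexE : AnalyticOnNhd ℂ complexE rightHalf := by
  intro q hq
  have hq : 0 < q.1.re := hq
  have h0 : q.1 ≠ 0 := by rintro h; simp [h] at hq
  have hslit : 4 * (Real.pi : ℂ) * Complex.I * q.1 ∈ Complex.slitPlane := by
    right
    have : (4 * (Real.pi : ℂ) * Complex.I * q.1).im = 4 * Real.pi * q.1.re := by simp
    rw [this]
    positivity
  have hfst : AnalyticAt ℂ (fun q : ℂ × ℂ => q.1) q := analyticAt_fst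
  have hsnd : AnalyticAt ℂ (fun q : ℂ × ℂ => q.2) q := analyticAt_snd
  unfold complexE
  refine AnalyticAt.div (AnalyticAt.cexp ?_) ((analyticAt_const.mul hfst).cpow analyticAt_const
    hslit) ?_
  · exact (analyticAt_const.mul (hsnd.pow 2)).div (analyticAt_const.mul hfst) (by simpa using h0)
  · rw [Ne, Complex.cpow_eq_zero_iff]
    exact fun h => Complex.slitPlane_ne_zero hslit h.1

theorem norm_complexE_le {a b : ℝ} (ha : 0 < a) {q : ℂ × ℂ} (hz : a ≤ ‖q.1‖) (hu : ‖q.2‖ ≤ b) :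
    ‖complexE q‖ ≤ Real.exp (b ^ 2 / (4 * a)) / (4 * Real.pi * a) ^ ((1 : ℝ) / 2) := by
  have hcast : ((1 : ℂ) / 2) = (((1 : ℝ) / 2 : ℝ) : ℂ) := by push_cast; rfl
  have hpi := Real.pi_pos
  rw [complexE, norm_div, hcast, Complex.norm_cpow_real]
  have hn : ‖4 * (Real.pi : ℂ) * Complex.I * q.1‖ = 4 * Real.pi * ‖q.1‖ := by
    simp [abs_of_pos hpi]
  rw [hn]
  gcongr
  refine (Complex.norm_exp_le_exp_norm _).trans ?_
  rw [norm_div, norm_mul, norm_pow, norm_mul]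
  simp only [Complex.norm_I, one_mul, Complex.norm_ofNat]
  gcongr

theorem thetaMinus_eq_convKernel (θ₀ : ℝ → ℂ) (t x : ℝ) :
    thetaMinus θ₀ t x = convKernel (thetaOdd θ₀) complexE t x := by
  simp [thetaMinus, convKernel, complexE, E]

theorem integrable_thetaOdd {θ₀ : ℝ → ℂ} (h : IntegrableOn θ₀ (Set.Ioo (0 : ℝ) 1)) :
    Integrable (thetaOdd θ₀) := by
  have h1 : Integrable ((Set.Ioo (0 : ℝ) 1).indicator θ₀) := h.integrable_indicator measurableSet_Ioo
  refine (h1.sub h1.comp_neg).congr (Filter.Eventually.of_forall fun x => ?_)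
  simp only [Pi.sub_apply, Set.indicator, Set.mem_Ioo, thetaOdd]
  by_cases hx : 0 < x ∧ x < 1
  · have : ¬ (0 < -x ∧ -x < 1) := by rintro ⟨h, -⟩; linarith [hx.1]
    simp [hx, not_lt.2 hx.1.le]
  · have hiff : (0 < -x ∧ -x < 1) ↔ (-1 < x ∧ x < 0) := by
      constructor <;> rintro ⟨h, h'⟩ <;> constructor <;> linarith
    simp only [if_neg hx, hiff]
    split_ifs <;> simp

theorem norm_convKernel_complexE_le {θ : ℝ → ℂ} (hθ : IntegrableOn θ (Set.Ioo (-1 : ℝ) 1))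
    {a b : ℝ} (ha : 0 < a) {z w : ℂ} (hz : a ≤ ‖z‖) (hw : ‖w‖ ≤ b) :
    ‖convKernel θ complexE z w‖ ≤
      Real.exp ((b + 1) ^ 2 / (4 * a)) / (4 * Real.pi * a) ^ ((1 : ℝ) / 2) *
        ∫ y in Set.Ioo (-1 : ℝ) 1, ‖θ y‖ := by
  rw [← integral_const_mul]
  refine norm_integral_le_of_norm_le (hθ.norm.const_mul _) ?_
  filter_upwards [ae_restrict_mem measurableSet_Ioo] with y hy
  rw [norm_mul]
  refine mul_le_mul_of_nonneg_right (norm_complexE_le ha hz ?_) (norm_nonneg _)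
  have hy1 : ‖(y : ℂ)‖ ≤ 1 := by
    rw [Complex.norm_real, Real.norm_eq_abs, abs_le]
    exact ⟨hy.1.le, hy.2.le⟩
  exact (norm_sub_le _ _).trans (add_le_add hw hy1)

theorem factorial_div_sqrt_succ_pow_le (n : ℕ) :
    (n.factorial : ℝ) / √((n : ℝ) + 1) ^ n ≤ (n.factorial : ℝ) ^ ((1 : ℝ) / 2) := by
  rw [← Real.sqrt_eq_rpow, div_le_iff₀ (by positivity)]
  have h1 : (n.factorial : ℝ) ≤ ((n : ℝ) + 1) ^ n := by
    have h : (n.factorial : ℝ) ≤ (n : ℝ) ^ n := by exact_mod_cast Nat.factorial_le_pow n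
    exact h.trans (by gcongr; linarith)
  calc (n.factorial : ℝ) = √(n.factorial : ℝ) * √(n.factorial : ℝ) :=
        (Real.mul_self_sqrt (by positivity)).symm
    _ ≤ √(n.factorial : ℝ) * √(((n : ℝ) + 1) ^ n) := by gcongr
    _ = √(n.factorial : ℝ) * √((n : ℝ) + 1) ^ n := by
        rw [Real.sqrt_eq_rpow (((n : ℝ) + 1) ^ n), Real.sqrt_eq_rpow ((n : ℝ) + 1),
          ← Real.rpow_natCast, ← Real.rpow_natCast, ← Real.rpow_mul (by positivity),
          ← Real.rpow_mul (by positivity), mul_comm ((1 : ℝ) / 2)]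

theorem stmt3 (θ₀ : ℝ → ℂ)
    (hθ₀ : MeasureTheory.MemLp θ₀ 2 (MeasureTheory.volume.restrict (Set.Ioo (0 : ℝ) 1)))
    (t₁ t₂ L : ℝ) (ht₁ : 0 < t₁) (ht : t₁ < t₂) (hL : 0 < L) :
    -- θ⁻ is Gevrey of order (1, 1/2) on [t₁,t₂] × [-L,L]
    ∃ M R₁ R₂ : ℝ, 0 < M ∧ 0 < R₁ ∧ 0 < R₂ ∧
      ∀ p₁ p₂ : ℕ, ∀ t ∈ Set.Icc t₁ t₂, ∀ x ∈ Set.Icc (-L) L,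
        ‖iteratedDeriv p₁ (fun t' => iteratedDeriv p₂ (fun x' => thetaMinus θ₀ t' x') x) t‖
          ≤ M * (p₁.factorial : ℝ) * ((p₂.factorial : ℝ) ^ ((1 : ℝ) / 2))
            / (R₁ ^ p₁ * R₂ ^ p₂) := by

  have hint : IntegrableOn (thetaOdd θ₀) (Set.Ioo (-1 : ℝ) 1) :=
    (integrable_thetaOdd (hθ₀.integrable (by norm_num))).integrableOn
  have hpi := Real.pi_pos
  set N : ℝ := ∫ y in Set.Ioo (-1 : ℝ) 1, ‖thetaOdd θ₀ y‖
  have hN : 0 ≤ N := integral_nonneg fun _ => norm_nonneg _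
  set D : ℝ := (4 * Real.pi * (t₁ / 2)) ^ ((1 : ℝ) / 2)
  have hD : 0 < D := by positivity
  set A : ℝ := Real.exp ((L + 1) ^ 2 / t₁) * Real.exp (1 / t₁) / D * N
  have hA : 0 ≤ A := by positivity
  refine ⟨A + 1, t₁ / 2, Real.exp (-(1 / t₁)), by positivity, by positivity, Real.exp_pos _, ?_⟩
  intro m n t ht x hx
  simp only [thetaMinus_eq_convKernel]
  set r : ℝ := √((n : ℝ) + 1)
  have hr : 0 < r := by positivity
  have hr2 : r ^ 2 = n + 1 := Real.sq_sqrt (by positivity)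
  have hbound : ∀ z w : ℂ, ‖z - t‖ ≤ t₁ / 2 → ‖w - x‖ ≤ r →
      ‖convKernel (thetaOdd θ₀) complexE z w‖ ≤ A * Real.exp (1 / t₁) ^ n := by
    intro z w hz hw
    have hz' : t₁ / 2 ≤ ‖z‖ := by
      have h1 := norm_sub_norm_le (t : ℂ) z
      rw [norm_sub_rev, Complex.norm_real, Real.norm_eq_abs] at h1
      linarith [le_abs_self t, ht.1]
    have hw' : ‖w‖ ≤ L + r := by
      have h1 := norm_sub_norm_le w (x : ℂ)
      rw [Complex.norm_real, Real.norm_eq_abs] at h1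
      linarith [abs_le.2 ⟨hx.1, hx.2⟩]
    refine (norm_convKernel_complexE_le hint (by positivity) hz' hw').trans ?_
    have hexp : Real.exp ((L + r + 1) ^ 2 / (4 * (t₁ / 2))) ≤
        Real.exp ((L + 1) ^ 2 / t₁) * Real.exp (1 / t₁) * Real.exp (1 / t₁) ^ n := by
      rw [← Real.exp_nat_mul, ← Real.exp_add, ← Real.exp_add, Real.exp_le_exp]
      have h2 : (L + 1) ^ 2 / t₁ + 1 / t₁ + n * (1 / t₁) =
          (2 * (L + 1) ^ 2 + 2 * r ^ 2) / (4 * (t₁ / 2)) := by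
        rw [hr2]
        field_simp
        ring
      rw [h2]
      gcongr
      nlinarith [sq_nonneg (L + 1 - r)]
    calc _ ≤ Real.exp ((L + 1) ^ 2 / t₁) * Real.exp (1 / t₁) * Real.exp (1 / t₁) ^ n / D * N := by
          gcongr
      _ = A * Real.exp (1 / t₁) ^ n := by ring
  refine (norm_iteratedDeriv_iteratedDeriv_convKernel_le hint analyticOnNhd_complexE m n
    (by positivity) (by linarith [ht.1]) hr hbound).trans ?_
  have hfac := factorial_div_sqrt_succ_pow_le n
  have hinv : Real.exp (-(1 / t₁)) ^ n = (Real.exp (1 / t₁) ^ n)⁻¹ := by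
    rw [Real.exp_neg, inv_pow]
  rw [hinv]
  calc (m.factorial : ℝ) * (n.factorial * (A * Real.exp (1 / t₁) ^ n) / r ^ n) / (t₁ / 2) ^ m
      = A * m.factorial * (n.factorial / r ^ n) * (Real.exp (1 / t₁) ^ n / (t₁ / 2) ^ m) := by ring
    _ ≤ (A + 1) * m.factorial * (n.factorial : ℝ) ^ ((1 : ℝ) / 2) *
        (Real.exp (1 / t₁) ^ n / (t₁ / 2) ^ m) := by
          gcongr
          linarith
    _ = _ := by
          rw [div_mul_eq_div_div, div_inv_eq_mul]
          ring
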